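/- For all n ≥ 1 and k ≥ 1, the following identity holds in ℚ[x_1,…,x_k,t]: W̃_n(x,t) = Σ_{λ ⊢ n} (−1)^{n−ℓ(λ)} c_λ(t) p_λ(x)/z_λ, where W̃_n(x,t) := Σ_w t^{cdes(w)} x_w (sum over all Smirnov words w of length n over [k]), c_λ(t) := A_{ℓ(λ)−1}(t) · Σ_{i=1}^{ℓ(λ)} λ_i t^{λ_i} ∏_{j ∈ [ℓ(λ)]∖{i}} [λ_j]_t for ℓ(λ) ≥ 2, and c_{(n)}(t) := n t^{n−1}. (This is the statement ω W̃_n(x,t) = Σ_{λ⊢n} c_λ(t) p_λ(x)/z_λ for the standard involution ω on symmetric functions, rewritten without ω using ω p_λ = (−1)^{n−ℓ(λ)} p_λ.) -/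

import Mathlib

open Finset MvPolynomial Polynomial

attribute [local instance] Classical.propDecidable

noncomputable section

/-- The descent number of a word `w = w₁⋯wₙ` over the alphabet `[k]`:
the number of indices `i ∈ [n-1]` with `wᵢ > wᵢ₊₁`. -/
def desc {n k : ℕ} (w : Fin n → Fin k) : ℕ :=
  (Finset.univ.filter fun i : Fin n =>
    ∃ h : (i : ℕ) + 1 < n, w ⟨(i : ℕ) + 1, h⟩ < w i).card

/-- The cyclic descent number: the number of indices `i ∈ [n]` with `wᵢ > wᵢ₊₁`,
where `wₙ₊₁ := w₁`. -/
def cdesc {n k : ℕ} (w : Fin n → Fin k) : ℕ :=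
  (Finset.univ.filter fun i : Fin n =>
    w ⟨((i : ℕ) + 1) % n, Nat.mod_lt _ i.pos⟩ < w i).card

/-- A word is Smirnov if no two adjacent letters are equal. -/
def IsSmirnov {n k : ℕ} (w : Fin n → Fin k) : Prop :=
  ∀ i : Fin n, ∀ h : (i : ℕ) + 1 < n, w ⟨(i : ℕ) + 1, h⟩ ≠ w i

/-- the first letter is strictly smaller than the last letter -/
def FirstLtLast {n k : ℕ} (w : Fin n → Fin k) : Prop :=
  ∃ h : 0 < n, w ⟨0, h⟩ < w ⟨n - 1, Nat.sub_lt h Nat.one_pos⟩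

/-- the first letter is strictly larger than the last letter -/
def FirstGtLast {n k : ℕ} (w : Fin n → Fin k) : Prop :=
  ∃ h : 0 < n, w ⟨n - 1, Nat.sub_lt h Nat.one_pos⟩ < w ⟨0, h⟩

/-- the first letter equals the last letter -/
def FirstEqLast {n k : ℕ} (w : Fin n → Fin k) : Prop :=
  ∃ h : 0 < n, w ⟨0, h⟩ = w ⟨n - 1, Nat.sub_lt h Nat.one_pos⟩

/-- the first letter differs from the last letter -/
def FirstNeLast {n k : ℕ} (w : Fin n → Fin k) : Prop :=
  ∃ h : 0 < n, w ⟨0, h⟩ ≠ w ⟨n - 1, Nat.sub_lt h Nat.one_pos⟩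

/-- the monomial `x_w = x_{w₁}⋯x_{wₙ}` -/
def xw (R : Type) [CommRing R] {n k : ℕ} (w : Fin n → Fin k) : MvPolynomial (Fin k) R :=
  ∏ i, MvPolynomial.X (w i)

/-- Generic restricted Smirnov word enumerator: the sum of `t^(stat w) · x_w` over all
Smirnov words `w` of length `n` over `[k]` satisfying `P`, as a polynomial in `t`
with coefficients in `R[x₁,…,x_k]`. -/
def smirnovEnum (R : Type) [CommRing R] (n k : ℕ) (stat : (Fin n → Fin k) → ℕ)
    (P : (Fin n → Fin k) → Prop) : Polynomial (MvPolynomial (Fin k) R) :=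
  ∑ w ∈ Finset.univ.filter (fun w : Fin n → Fin k => IsSmirnov w ∧ P w),
    Polynomial.X ^ stat w * Polynomial.C (xw R w)

/-- the t-analogue `[m]_t = 1 + t + ⋯ + t^(m-1)`, as a polynomial in `t = Polynomial.X`
with coefficients in `R[x₁,…,x_k]` -/
def tnum (R : Type) [CommRing R] (k m : ℕ) : Polynomial (MvPolynomial (Fin k) R) :=
  ∑ j ∈ Finset.range m, Polynomial.X ^ j

/-- `D(x,t,z) = 1 - Σ_{i≥2} t[i-1]_t e_i(x) z^i`, a formal power series in `z` whose
coefficients are polynomials in `t` with coefficients in `R[x₁,…,x_k]`. -/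
def Dser (R : Type) [CommRing R] (k : ℕ) : PowerSeries (Polynomial (MvPolynomial (Fin k) R)) :=
  PowerSeries.mk fun i =>
    if i = 0 then 1
    else if i = 1 then 0
    else -(Polynomial.X * tnum R k (i - 1) * Polynomial.C (esymm (Fin k) R i))

/-- `Des_{≥2}(σ) = {i ∈ [n-1] : σ(i) - σ(i+1) ≥ 2}`, recorded via 0-based gap positions:
gap `g ∈ {0,…,n-2}` corresponds to the adjacent pair `(σ g, σ (g+1))`. -/
def Des2 {n : ℕ} (σ : Equiv.Perm (Fin n)) : Finset ℕ :=
  (Finset.range n).filter fun g =>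
    ∃ h : g + 1 < n, (σ ⟨g + 1, h⟩ : ℕ) + 2 ≤ (σ ⟨g, Nat.lt_of_succ_lt h⟩ : ℕ)

/-- `Asc_{≥2}(σ) = {i ∈ [n-1] : σ(i+1) - σ(i) ≥ 2}`, recorded via 0-based gap positions. -/
def Asc2 {n : ℕ} (σ : Equiv.Perm (Fin n)) : Finset ℕ :=
  (Finset.range n).filter fun g =>
    ∃ h : g + 1 < n, (σ ⟨g, Nat.lt_of_succ_lt h⟩ : ℕ) + 2 ≤ (σ ⟨g + 1, h⟩ : ℕ)

/-- `maj_{≥2}(σ) = Σ i` over the (1-based) positions `i ∈ [n-1]` with `σ(i+1) - σ(i) ≥ 2`;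
a 0-based gap `g` corresponds to the 1-based position `g + 1`. -/
def maj2 {n : ℕ} (σ : Equiv.Perm (Fin n)) : ℕ :=
  ∑ g ∈ Asc2 σ, (g + 1)

/-- The Eulerian polynomial `A_m(t) = Σ_{σ ∈ S_m} t^{des σ}`. -/
def Eul (R : Type) [CommRing R] (m : ℕ) : Polynomial R :=
  ∑ σ : Equiv.Perm (Fin m), Polynomial.X ^ desc ⇑σ

/-- `z_λ = ∏_i i^{m_i} m_i!` where `m_i` is the number of parts of `λ` equal to `i` -/
def zlam {n : ℕ} (μ : n.Partition) : ℕ :=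
  ∏ i ∈ μ.parts.toFinset, i ^ μ.parts.count i * (μ.parts.count i).factorial

/-- the coefficient `c_λ(t)` of `p_λ/z_λ` in `ω W̃_n`:
`c_{(n)}(t) = n t^{n-1}` and, for `ℓ(λ) ≥ 2`,
`c_λ(t) = A_{ℓ(λ)-1}(t) Σ_i λ_i t^{λ_i} ∏_{j≠i} [λ_j]_t`. -/
def ctilde (k n : ℕ) (μ : n.Partition) : Polynomial (MvPolynomial (Fin k) ℚ) :=
  if μ.parts.card = 1 then
    (n : Polynomial (MvPolynomial (Fin k) ℚ)) * Polynomial.X ^ (n - 1)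
  else
    Eul (MvPolynomial (Fin k) ℚ) (μ.parts.card - 1) *
      (μ.parts.map (fun a : ℕ =>
        (a : Polynomial (MvPolynomial (Fin k) ℚ)) * Polynomial.X ^ a *
          ((μ.parts.erase a).map (tnum ℚ k)).prod)).sum

/-- transfer weight of two adjacent letters -/
def wt {R : Type} [CommRing R] {k : ℕ} (t : R) (c b : Fin k) : R :=
  if c = b then 0 else if b < c then t else 1

/-- weighted count of Smirnov words of length `n+1` ending in `b` -/
def gword {R : Type} [CommRing R] {k : ℕ} (t : R) (x f : Fin k → R) : ℕ → Fin k → R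
  | 0, b => x b * f b
  | n + 1, b => x b * ∑ c, wt t c b * gword t x f n c

lemma sum_words {R : Type} [CommRing R] {k : ℕ} (t : R) (x f : Fin k → R) (n : ℕ) :
    ∀ g : Fin k → R,
    ∑ w : Fin (n + 1) → Fin k, f (w 0) * (∏ i : Fin n, wt t (w i.castSucc) (w i.succ)) *
      (∏ i, x (w i)) * g (w (Fin.last n)) = ∑ b, gword t x f n b * g b := by
  induction n with
  | zero =>
    intro g
    rw [← (Equiv.funUnique (Fin 1) (Fin k)).symm.sum_comp]
    refine Finset.sum_congr rfl fun b _ => ?_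
    simp [gword]
    ring
  | succ n ih =>
    intro g
    rw [← (Fin.snocEquiv (fun _ : Fin (n + 2) => Fin k)).sum_comp, Fintype.sum_prod_type]
    have h1 : ∀ (b : Fin k) (w : Fin (n + 1) → Fin k),
        f ((Fin.snocEquiv (fun _ : Fin (n + 2) => Fin k)) (b, w) 0) *
        (∏ i : Fin (n + 1), wt t ((Fin.snocEquiv (fun _ : Fin (n + 2) => Fin k)) (b, w) i.castSucc)
          ((Fin.snocEquiv (fun _ : Fin (n + 2) => Fin k)) (b, w) i.succ)) *
        (∏ i, x ((Fin.snocEquiv (fun _ : Fin (n + 2) => Fin k)) (b, w) i)) *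
        g ((Fin.snocEquiv (fun _ : Fin (n + 2) => Fin k)) (b, w) (Fin.last (n + 1))) =
        f (w 0) * (∏ i : Fin n, wt t (w i.castSucc) (w i.succ)) *
      (∏ i, x (w i)) * (wt t (w (Fin.last n)) b * x b * g b) := by
      intro b w
      have e0 : (Fin.snocEquiv (fun _ : Fin (n + 2) => Fin k)) (b, w) =
        (Fin.snoc w b : Fin (n + 2) → Fin k) := rfl
      rw [e0]
      rw [Fin.prod_univ_castSucc (n := n), Fin.prod_univ_castSucc (n := n + 1)]
      have e1 : (Fin.snoc w b : Fin (n + 2) → Fin k) 0 = w 0 := by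
        rw [← Fin.castSucc_zero, Fin.snoc_castSucc]
      have e2 : ∀ i : Fin n, (Fin.snoc w b : Fin (n + 2) → Fin k) i.castSucc.succ = w i.succ := by
        intro i
        rw [Fin.succ_castSucc, Fin.snoc_castSucc]
      simp only [e1, e2, Fin.snoc_castSucc, Fin.succ_last, Fin.snoc_last]
      ring
    simp only [h1]
    rw [Finset.sum_comm]
    simp only [← Finset.mul_sum]
    rw [ih (fun c => ∑ b, wt t c b * x b * g b)]
    simp only [gword, Finset.mul_sum, Finset.sum_mul]
    rw [Finset.sum_comm]
    refine Finset.sum_congr rfl fun b _ => Finset.sum_congr rfl fun c _ => ?_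
    ring

lemma pow_card_filter {R ι : Type} [CommRing R] [Fintype ι] (t : R) (P : ι → Prop) [DecidablePred P] :
    t ^ (Finset.univ.filter P).card = ∏ i, if P i then t else 1 := by
  rw [Finset.prod_ite]
  simp

lemma smirnov_core {R : Type} [CommRing R] {n k : ℕ} (t : R) (w : Fin (n + 1) → Fin k) :
    (∏ i : Fin n, wt t (w i.castSucc) (w i.succ)) =
      if IsSmirnov w then ∏ i : Fin n, (if w i.succ < w i.castSucc then t else 1) else 0 := by
  by_cases h : IsSmirnov w
  · rw [if_pos h]
    refine Finset.prod_congr rfl fun i _ => ?_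
    have := h i.castSucc (by simp)
    have h2 : w i.succ ≠ w i.castSucc := this
    unfold wt
    rw [if_neg h2.symm]
  · rw [if_neg h]
    unfold IsSmirnov at h
    push Not at h
    obtain ⟨i, hi, h⟩ := h
    apply Finset.prod_eq_zero (Finset.mem_univ (⟨i, by omega⟩ : Fin n))
    unfold wt
    rw [if_pos]
    exact h.symm

lemma smirnov_weight {R : Type} [CommRing R] {n k : ℕ} (t : R) (w : Fin (n + 1) → Fin k) :
    (if IsSmirnov w then t ^ desc w else 0) =
      ∏ i : Fin n, wt t (w i.castSucc) (w i.succ) := by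
  rw [smirnov_core]
  congr 1
  unfold desc
  rw [pow_card_filter, Fin.prod_univ_castSucc]
  rw [if_neg (by simp), mul_one]
  refine Finset.prod_congr rfl fun i _ => ?_
  congr 1
  have : (i.castSucc : ℕ) + 1 < n + 1 := by simp
  exact propext ⟨fun ⟨_, h⟩ => h, fun h => ⟨this, h⟩⟩

lemma smirnov_cweight {R : Type} [CommRing R] {n k : ℕ} (t : R) (w : Fin (n + 1) → Fin k) :
    (if IsSmirnov w then t ^ cdesc w else 0) =
      (∏ i : Fin n, wt t (w i.castSucc) (w i.succ)) *
        (if w 0 < w (Fin.last n) then t else 1) := by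
  rw [smirnov_core, ite_mul, zero_mul]
  congr 1
  unfold cdesc
  rw [pow_card_filter, Fin.prod_univ_castSucc]
  congr 1
  · refine Finset.prod_congr rfl fun i _ => ?_
    have : (⟨((i.castSucc : Fin (n+1)) + 1 : ℕ) % (n + 1), Nat.mod_lt _ (Nat.succ_pos n)⟩ : Fin (n+1)) = i.succ := by
      ext
      simp [Nat.mod_eq_of_lt]
    rw [this]
  · have : (⟨((Fin.last n : Fin (n+1)) + 1 : ℕ) % (n + 1), Nat.mod_lt _ (Nat.succ_pos n)⟩ : Fin (n+1)) = 0 := by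
      ext
      simp
    rw [this]

/-- the interpolating sums -/
def Ssum {B : Type} [CommRing B] {k : ℕ} (T : B) (g : Fin k → B) (j : ℕ) : B :=
  ∑ c : Fin k, (if c.val < j then 1 else T) * g c

/-- initial products -/
def Ppre {B : Type} [CommRing B] {k : ℕ} (y : Fin k → B) (j : ℕ) : B :=
  ∏ c : Fin k, if c.val < j then 1 + y c else 1

/-- final products -/
def Psuf {B : Type} [CommRing B] {k : ℕ} (y : Fin k → B) (j : ℕ) : B :=
  ∏ c : Fin k, if j ≤ c.val then 1 + y c else 1

section telescoping
variable {B : Type} [CommRing B] {k : ℕ}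

lemma Ssum_succ (T : B) (g : Fin k → B) (j : Fin k) :
    Ssum T g (j + 1) = Ssum T g j + (1 - T) * g j := by
  have : (1 - T) * g j = ∑ c : Fin k, if c = j then (1 - T) * g c else 0 := by simp
  rw [this, Ssum, Ssum, ← Finset.sum_add_distrib]
  refine Finset.sum_congr rfl fun c _ => ?_
  rcases lt_trichotomy c j with h | h | h
  · have h' : c.val < j.val := h
    simp [h.ne, h', Nat.lt_succ_of_lt h']
  · subst h; simp; ring
  · have h' : j.val < c.val := h
    simp [h.ne', not_lt.mpr h'.le, not_lt.mpr (Nat.succ_le_of_lt h')]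

lemma Ppre_succ (y : Fin k → B) (j : Fin k) :
    Ppre y (j + 1) = Ppre y j * (1 + y j) := by
  have : (1 + y j) = ∏ c : Fin k, if c = j then 1 + y c else 1 := by simp
  rw [this, Ppre, Ppre, ← Finset.prod_mul_distrib]
  refine Finset.prod_congr rfl fun c _ => ?_
  rcases lt_trichotomy c j with h | h | h
  · have h' : c.val < j.val := h
    simp [h.ne, h', Nat.lt_succ_of_lt h']
  · subst h; simp
  · have h' : j.val < c.val := h
    simp [h.ne', not_lt.mpr h'.le, not_lt.mpr (Nat.succ_le_of_lt h')]

lemma Psuf_succ (y : Fin k → B) (j : Fin k) :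
    Psuf y j = Psuf y (j + 1) * (1 + y j) := by
  have : (1 + y j) = ∏ c : Fin k, if c = j then 1 + y c else 1 := by simp
  rw [this, Psuf, Psuf, ← Finset.prod_mul_distrib]
  refine Finset.prod_congr rfl fun c _ => ?_
  rcases lt_trichotomy c j with h | h | h
  · have h' : c.val < j.val := h
    simp [h.ne, not_le.mpr h', not_le.mpr (Nat.lt_succ_of_lt h')]
  · subst h; simp
  · have h' : j.val < c.val := h
    simp [h.ne', h'.le, (Nat.succ_le_of_lt h')]

lemma Ppre_mul_Psuf (y : Fin k → B) (j : ℕ) :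
    Ppre y j * Psuf y j = ∏ c, (1 + y c) := by
  rw [Ppre, Psuf, ← Finset.prod_mul_distrib]
  refine Finset.prod_congr rfl fun c _ => ?_
  by_cases h : c.val < j
  · simp [h, not_le.mpr h]
  · simp [h, not_lt.mp h]

lemma Ssum_zero (T : B) (g : Fin k → B) : Ssum T g 0 = T * ∑ c, g c := by
  simp [Ssum, Finset.mul_sum]

lemma Ssum_top (T : B) (g : Fin k → B) : Ssum T g k = ∑ c, g c := by
  simp [Ssum]

/-- the basic step -/
lemma Ssum_step (T : B) (y f g : Fin k → B)
    (hg : ∀ b, g b = y b * (f b + ∑ c, wt T c b * g c)) (j : Fin k) :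
    (1 + T * y j) * Ssum T g (j + 1) = (1 + y j) * Ssum T g j + (1 - T) * (y j * f j) := by
  have h1 : ∑ c, wt T c j * g c = Ssum T g j - T * g j := by
    have : T * g j = ∑ c : Fin k, if c = j then T * g c else 0 := by simp
    rw [this, Ssum, ← Finset.sum_sub_distrib]
    refine Finset.sum_congr rfl fun c _ => ?_
    unfold wt
    rcases lt_trichotomy c j with h | h | h
    · have h' : c.val < j.val := h
      simp [h.ne, h', not_lt.mpr h.le]
    · subst h; simp
    · have h' : j.val < c.val := h
      simp [h.ne', not_lt.mpr h'.le, h]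
  have h2 := hg j
  rw [h1] at h2
  rw [Ssum_succ]
  linear_combination (1 - T) * h2

lemma linear_telescoped (T : B) (y g : Fin k → B)
    (hg : ∀ b, g b = y b * (1 + ∑ c, wt T c b * g c)) :
    (1 + ∑ c, g c) * (∏ c, (1 + T * y c) - T * ∏ c, (1 + y c)) = (1 - T) * ∏ c, (1 + y c) := by
  have key : ∀ j : ℕ, j ≤ k → Ppre (fun c => T * y c) j * (1 + Ssum T g j) =
      Ppre y j * (1 + Ssum T g 0) := by
    intro j
    induction j with
    | zero => intro _; simp [Ppre]
    | succ j ih =>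
      intro hj
      have ih := ih (by omega)
      have e1 := Ppre_succ (fun c => T * y c) ⟨j, hj⟩
      have e2 := Ppre_succ y ⟨j, hj⟩
      have e3 := Ssum_step T y (fun _ => 1) g hg ⟨j, hj⟩
      simp only at e1 e2 e3
      rw [e1, e2]
      linear_combination (1 + y ⟨j, hj⟩) * ih + Ppre (fun c => T * y c) j * e3
  have := key k le_rfl
  rw [Ssum_zero, Ssum_top] at this
  have e1 : Ppre (fun c => T * y c) k = ∏ c, (1 + T * y c) := by simp [Ppre]
  have e2 : Ppre y k = ∏ c, (1 + y c) := by simp [Ppre]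
  rw [e1, e2] at this
  linear_combination this

lemma cyclic_telescoped (T : B) (y g : Fin k → B) (a : Fin k)
    (hg : ∀ b, g b = y b * ((if b = a then 1 else 0) + ∑ c, wt T c b * g c)) :
    Ssum T g (a + 1) * (∏ c, (1 + T * y c) - T * ∏ c, (1 + y c)) =
      (1 - T) * (y a * ∏ c ∈ Finset.univ.erase a, (1 + T * y c)) := by
  have hstep := Ssum_step T y _ g hg
  have key1 : ∀ j : ℕ, j ≤ a → Ppre (fun c => T * y c) j * Ssum T g j =
      Ppre y j * Ssum T g 0 := by
    intro j
    induction j with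
    | zero => intro _; simp [Ppre]
    | succ j ih =>
      intro hj
      have ih := ih (by omega)
      have hjk : j < k := by have := a.2; omega
      have e1 := Ppre_succ (fun c => T * y c) ⟨j, hjk⟩
      have e2 := Ppre_succ y ⟨j, hjk⟩
      have e3 := hstep ⟨j, hjk⟩
      rw [if_neg (by intro h; rw [← h] at hj; simp at hj)] at e3
      simp only at e1 e2 e3
      rw [e1, e2]
      linear_combination (1 + y ⟨j, hjk⟩) * ih + Ppre (fun c => T * y c) j * e3
  have key2 : ∀ d j : ℕ, j + d = k → a + 1 ≤ j → Psuf (fun c => T * y c) j * Ssum T g k =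
      Psuf y j * Ssum T g j := by
    intro d
    induction d with
    | zero =>
      intro j hj _
      have : j = k := by omega
      subst this
      have h1 : Psuf (fun c => T * y c) j = 1 := by
        unfold Psuf; exact Finset.prod_eq_one fun c _ => if_neg (not_le.mpr c.2)
      have h2 : Psuf y j = 1 := by
        unfold Psuf; exact Finset.prod_eq_one fun c _ => if_neg (not_le.mpr c.2)
      rw [h1, h2]
    | succ d ih =>
      intro j hj ha
      have ih := ih (j + 1) (by omega) (by omega)
      have hjk : j < k := by omega
      have e1 := Psuf_succ (fun c => T * y c) ⟨j, hjk⟩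
      have e2 := Psuf_succ y ⟨j, hjk⟩
      have e3 := hstep ⟨j, hjk⟩
      rw [if_neg (by intro h; rw [← h] at ha; simp at ha)] at e3
      simp only at e1 e2 e3
      rw [e1, e2]
      linear_combination (1 + T * y ⟨j, hjk⟩) * ih + Psuf y (j + 1) * e3
  have k1 := key1 a le_rfl
  have k2 := key2 (k - (a + 1)) (a + 1) (by have := a.2; omega) le_rfl
  have k3 := hstep a
  rw [if_pos rfl] at k3
  rw [← Ppre_mul_Psuf (fun c => T * y c) (a + 1), ← Ppre_mul_Psuf y (a + 1)]
  have e1 := Ppre_succ (fun c => T * y c) a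
  have e2 := Ppre_succ y a
  rw [Ssum_zero, ← Ssum_top T g] at k1
  have e4 : ∏ c ∈ Finset.univ.erase a, (1 + T * y c) =
      Ppre (fun c => T * y c) a * Psuf (fun c => T * y c) (a + 1) := by
    rw [Ppre, Psuf, ← Finset.prod_mul_distrib, ← Finset.mul_prod_erase Finset.univ _ (Finset.mem_univ a)]
    simp only [lt_irrefl, if_false, Nat.succ_le_iff, one_mul]
    refine Finset.prod_congr rfl fun c hc => ?_
    have hc := (Finset.mem_erase.mp hc).1
    rcases lt_or_gt_of_ne hc with h | h
    · have h' : c.val < a.val := h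
      simp [h', not_lt.mpr h'.le]
    · have h' : a.val < c.val := h
      simp [h', not_lt.mpr h'.le]
  rw [e4, e1, e2]
  rw [e2] at *
  linear_combination Psuf (fun c => T * y c) (a + 1) * ((1 + y a) * k1 + Ppre (fun c => T * y c) a * k3) +
    T * Ppre y a * (1 + y a) * k2

end telescoping


section genser
variable {R : Type} [CommRing R] {k : ℕ}

/-- generating series of `gword` -/
def gser (t : R) (x f : Fin k → R) (b : Fin k) : PowerSeries R :=
  PowerSeries.X * PowerSeries.mk (fun n => gword t x f n b)

lemma wt_C (t : R) (c b : Fin k) :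
    wt (PowerSeries.C t) c b = PowerSeries.C (wt t c b) := by
  unfold wt
  split_ifs <;> simp

lemma gser_eq (t : R) (x f : Fin k → R) (b : Fin k) :
    gser t x f b = (PowerSeries.X * PowerSeries.C (x b)) *
      (PowerSeries.C (f b) + ∑ c, wt (PowerSeries.C t) c b * gser t x f c) := by
  rw [gser, mul_assoc]
  congr 1
  ext n
  rw [PowerSeries.coeff_mk, PowerSeries.coeff_C_mul, map_add, map_sum]
  cases n with
  | zero => simp [gword, gser, wt_C]
  | succ n =>
    simp only [gword, wt_C, gser, PowerSeries.coeff_C_mul, PowerSeries.coeff_succ_X_mul,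
      PowerSeries.coeff_mk, PowerSeries.coeff_C, Nat.succ_ne_zero, if_false, zero_add]

/-- `E(z)` -/
def Eser (x : Fin k → R) : PowerSeries R := ∏ c, (1 + PowerSeries.X * PowerSeries.C (x c))

/-- `E(tz)` -/
def Etser (t : R) (x : Fin k → R) : PowerSeries R :=
  ∏ c, (1 + PowerSeries.C t * (PowerSeries.X * PowerSeries.C (x c)))

/-- `E(tz) - t E(z)` -/
def Den (t : R) (x : Fin k → R) : PowerSeries R := Etser t x - PowerSeries.C t * Eser x

/-- linear word series -/
def Vser (t : R) (x : Fin k → R) : PowerSeries R := 1 + ∑ b, gser t x (fun _ => 1) b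

/-- cyclic word series -/
def Cser (t : R) (x : Fin k → R) : PowerSeries R :=
  ∑ a : Fin k, Ssum (PowerSeries.C t) (gser t x (fun b => if b = a then 1 else 0)) (a + 1)

/-- `P(tz)`, where `P` is the logarithmic derivative of `E` -/
def Ptser (t : R) (x : Fin k → R) : PowerSeries R :=
  ∑ a, PowerSeries.C (x a) * PowerSeries.mk (fun i => (-(t * x a)) ^ i)

lemma Vser_mul_Den (t : R) (x : Fin k → R) :
    Vser t x * Den t x = (1 - PowerSeries.C t) * Eser x := by
  refine linear_telescoped (PowerSeries.C t) (fun c => PowerSeries.X * PowerSeries.C (x c)) _ ?_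
  intro b
  conv_lhs => rw [gser_eq]
  simp

lemma geom_inv (t : R) (y : R) :
    (1 + PowerSeries.C t * (PowerSeries.X * PowerSeries.C y)) *
      PowerSeries.mk (fun i => (-(t * y)) ^ i) = 1 := by
  ext n
  have : (1 + PowerSeries.C t * (PowerSeries.X * PowerSeries.C y)) =
    1 + PowerSeries.X * PowerSeries.C (t * y) := by
    rw [map_mul]; ring
  rw [this, add_mul, one_mul, mul_assoc, map_add]
  cases n with
  | zero => simp
  | succ n =>
    rw [PowerSeries.coeff_succ_X_mul, PowerSeries.coeff_C_mul]
    simp [PowerSeries.coeff_one, pow_succ]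
    ring

lemma erase_prod_sum (t : R) (x : Fin k → R) :
    ∑ a : Fin k, PowerSeries.C (x a) * ∏ c ∈ Finset.univ.erase a,
      (1 + PowerSeries.C t * (PowerSeries.X * PowerSeries.C (x c))) = Ptser t x * Etser t x := by
  rw [Ptser, Finset.sum_mul]
  refine Finset.sum_congr rfl fun a _ => ?_
  rw [Etser, ← Finset.mul_prod_erase Finset.univ _ (Finset.mem_univ a)]
  linear_combination (-(PowerSeries.C (x a) * ∏ c ∈ Finset.univ.erase a,
      (1 + PowerSeries.C t * (PowerSeries.X * PowerSeries.C (x c))))) * geom_inv t (x a)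

lemma Cser_mul_Den (t : R) (x : Fin k → R) :
    Cser t x * Den t x =
      (1 - PowerSeries.C t) * (PowerSeries.X * (Ptser t x * Etser t x)) := by
  rw [← erase_prod_sum, Cser, Finset.sum_mul, Finset.mul_sum, Finset.mul_sum]
  refine Finset.sum_congr rfl fun a _ => ?_
  have := cyclic_telescoped (PowerSeries.C t) (fun c => PowerSeries.X * PowerSeries.C (x c))
    (gser t x (fun b => if b = a then 1 else 0)) a ?_
  · rw [Den, Etser, Eser, this]
    ring
  · intro b
    conv_lhs => rw [gser_eq]
    congr 2
    split_ifs <;> simp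

lemma Den_ne_zero (t : R) (x : Fin k → R) (ht : t ≠ 1) : Den t x ≠ 0 := by
  intro h
  have := congrArg PowerSeries.constantCoeff h
  simp [Den, Etser, Eser, map_prod] at this
  exact ht (sub_eq_zero.mp this).symm

/-- derivative of a product -/
lemma deriv_prod (s : R) (x : Fin k → R) :
    PowerSeries.derivative R (Etser s x) = PowerSeries.C s * (Ptser s x * Etser s x) := by
  have gen : ∀ (I : Finset (Fin k)) (F : Fin k → PowerSeries R),
      PowerSeries.derivative R (∏ c ∈ I, F c) =
        ∑ a ∈ I, PowerSeries.derivative R (F a) * ∏ c ∈ I.erase a, F c := by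
    intro I F
    induction I using Finset.induction_on with
    | empty => simp
    | insert a I ha ih =>
      rw [Finset.prod_insert ha, Derivation.leibniz, ih, Finset.sum_insert ha,
        Finset.erase_insert ha, smul_eq_mul, smul_eq_mul, Finset.mul_sum, add_comm, mul_comm]
      congr 1
      refine Finset.sum_congr rfl fun c hc => ?_
      have hne : c ≠ a := fun h => ha (h ▸ hc)
      rw [Finset.erase_insert_of_ne hne.symm, Finset.prod_insert (fun h => ha (Finset.mem_of_mem_erase h))]
      ring
  rw [← erase_prod_sum, Etser, gen, Finset.mul_sum]
  refine Finset.sum_congr rfl fun a _ => ?_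
  simp only [map_add, Derivation.leibniz, PowerSeries.derivative_X, PowerSeries.derivative_C, smul_eq_mul,
    PowerSeries.derivative_one]
  ring

lemma Eser_eq (x : Fin k → R) : Eser x = Etser 1 x := by
  simp [Eser, Etser]

end genser

section comp
variable {R : Type} [CommRing R] [Algebra ℚ R] {k : ℕ}

/-- `β_m(t) / m!` -/
def bco (t : R) : ℕ → R
  | 0 => 1
  | m + 1 => (1 / ((m : ℚ) + 1)) • (∑ i : Fin (m + 1), bco t i * bco t (m - i) - (1 - t) * bco t m)
termination_by m => m
decreasing_by all_goals omega

lemma bco_succ (t : R) (m : ℕ) : bco t (m + 1) * ((m : R) + 1) =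
    ∑ p ∈ Finset.HasAntidiagonal.antidiagonal m, bco t p.1 * bco t p.2 - (1 - t) * bco t m := by
  rw [bco, Finset.Nat.sum_antidiagonal_eq_sum_range_succ (fun i j => bco t i * bco t j),
    Finset.sum_range]
  have : ((m : R) + 1) = algebraMap ℚ R ((m : ℚ) + 1) := by simp
  rw [this, smul_mul_assoc, mul_comm, ← Algebra.smul_def, smul_smul]
  rw [one_div_mul_cancel (by positivity), one_smul]

lemma bco_map {S : Type} [CommRing S] [Algebra ℚ S] (φ : R →+* S) (t : R) (m : ℕ) :
    φ (bco t m) = bco (φ t) m := by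
  induction m using Nat.strong_induction_on with
  | _ m ih =>
    cases m with
    | zero => simp [bco]
    | succ m =>
      rw [bco, bco]
      have hs : ∀ (q : ℚ) (r : R), φ (q • r) = q • φ r := fun q r => map_rat_smul φ q r
      rw [hs, map_sub, map_sum, map_mul, map_sub, map_one, ih m (by omega)]
      congr 2
      refine Finset.sum_congr rfl fun i _ => ?_
      rw [map_mul, ih i (by omega), ih (m - i) (by omega)]

/-- the generating function `Φ(u)` -/
def Phi (t : R) : PowerSeries R := PowerSeries.mk (bco t)

lemma deriv_Phi (t : R) : PowerSeries.derivative R (Phi t) =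
    Phi t * Phi t - (1 - PowerSeries.C t) * Phi t := by
  ext m
  have : (1 - PowerSeries.C t) = PowerSeries.C (1 - t) := by simp
  rw [PowerSeries.coeff_derivative, this, map_sub, PowerSeries.coeff_C_mul, PowerSeries.coeff_mul]
  simp only [Phi, PowerSeries.coeff_mk]
  rw [bco_succ]

/-- coefficients of `Q` -/
def qco (t : R) (x : Fin k → R) (i : ℕ) : R :=
  ((-1 : ℚ) ^ (i - 1) / (i : ℚ)) • ((∑ j ∈ Finset.range i, t ^ j) * ∑ c, x c ^ i)

/-- `Q(z)` -/
def Qser (t : R) (x : Fin k → R) : PowerSeries R := PowerSeries.mk (qco t x)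

lemma Qser_const (t : R) (x : Fin k → R) : PowerSeries.constantCoeff (Qser t x) = 0 := by
  rw [← PowerSeries.coeff_zero_eq_constantCoeff_apply]
  simp [Qser, qco]

lemma Qser_hasSubst (t : R) (x : Fin k → R) : PowerSeries.HasSubst (Qser t x) :=
  PowerSeries.HasSubst.of_constantCoeff_zero' (Qser_const t x)

lemma deriv_Q (t : R) (x : Fin k → R) :
    (1 - PowerSeries.C t) * PowerSeries.derivative R (Qser t x) =
      Ptser 1 x - PowerSeries.C t * Ptser t x := by
  ext i
  have : (1 - PowerSeries.C t) = PowerSeries.C (1 - t) := by simp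
  rw [this, PowerSeries.coeff_C_mul, PowerSeries.coeff_derivative, map_sub, PowerSeries.coeff_C_mul]
  simp only [Ptser, Qser, map_sum, PowerSeries.coeff_C_mul, PowerSeries.coeff_mk, qco]
  have h1 : ((i : R) + 1) = algebraMap ℚ R ((i : ℚ) + 1) := by simp
  have h2 : (((-1 : ℚ) ^ (i + 1 - 1) / ((i + 1 : ℕ) : ℚ)) •
      ((∑ j ∈ Finset.range (i + 1), t ^ j) * ∑ c, x c ^ (i + 1))) * ((i : R) + 1) =
      (-1) ^ i * ((∑ j ∈ Finset.range (i + 1), t ^ j) * ∑ c, x c ^ (i + 1)) := by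
    rw [h1, mul_comm, ← Algebra.smul_def, smul_smul]
    have : ((i : ℚ) + 1) * ((-1 : ℚ) ^ (i + 1 - 1) / ((i + 1 : ℕ) : ℚ)) = (-1) ^ i := by
      have : ((i : ℚ) + 1) ≠ 0 := by positivity
      push_cast
      field_simp
    rw [this, Algebra.smul_def]
    simp
  rw [h2]
  have h3 := mul_neg_geom_sum t (i + 1)
  calc _ = (-1) ^ i * (((1 - t) * (∑ j ∈ Finset.range (i + 1), t ^ j)) * ∑ c, x c ^ (i + 1)) := by ring
    _ = _ := by
      rw [h3, Finset.mul_sum, Finset.mul_sum, Finset.mul_sum, ← Finset.sum_sub_distrib]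
      refine Finset.sum_congr rfl fun c _ => ?_
      rw [neg_pow (1 * x c), neg_pow (t * x c), mul_pow, mul_pow]
      ring

/-- `Ψ = Φ ∘ Q` -/
def Psi (t : R) (x : Fin k → R) : PowerSeries R := (Phi t).subst (Qser t x)

lemma deriv_Psi (t : R) (x : Fin k → R) : PowerSeries.derivative R (Psi t x) =
    Psi t x * (Psi t x - (1 - PowerSeries.C t)) * PowerSeries.derivative R (Qser t x) := by
  have hQ := Qser_hasSubst t x
  rw [Psi, PowerSeries.derivative_subst hQ, deriv_Phi]
  congr 1
  have hC : (1 - PowerSeries.C t) = PowerSeries.C (1 - t) := by simp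
  rw [hC, ← PowerSeries.coe_substAlgHom hQ, map_sub, map_mul, ← PowerSeries.smul_eq_C_mul, map_smul,
    PowerSeries.smul_eq_C_mul]
  ring

lemma Psi_const (t : R) (x : Fin k → R) : PowerSeries.constantCoeff (Psi t x) = 1 := by
  rw [← PowerSeries.coeff_zero_eq_constantCoeff_apply, Psi,
    PowerSeries.coeff_subst' (Qser_hasSubst t x), finsum_eq_single _ 0]
  · simp [Phi, bco]
  · intro n hn
    simp [Qser_const, hn]

lemma ode_unique (H K : PowerSeries R) (h0 : PowerSeries.constantCoeff H = 0)
    (h : PowerSeries.derivative R H = K * H) : H = 0 := by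
  ext n
  induction n using Nat.strong_induction_on with
  | _ n ih =>
    cases n with
    | zero => simpa using h0
    | succ n =>
      have h1 := congrArg (PowerSeries.coeff n) h
      rw [PowerSeries.coeff_derivative, PowerSeries.coeff_mul, Finset.sum_eq_zero] at h1
      · have e : ((n : R) + 1) = algebraMap ℚ R ((n : ℚ) + 1) := by simp
        rw [e, mul_comm, ← Algebra.smul_def] at h1
        have h2 := congrArg (fun r => ((n : ℚ) + 1)⁻¹ • r) h1
        simp only [smul_smul, smul_zero] at h2
        rw [inv_mul_cancel₀ (by positivity), one_smul] at h2
        simpa using h2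
      · rintro ⟨i, j⟩ hij
        have : i + j = n := by simpa using hij
        rw [ih j (by omega)]
        simp

lemma Psi_mul_Den (t : R) (x : Fin k → R) :
    Psi t x * Den t x = (1 - PowerSeries.C t) * Etser t x := by
  rw [← sub_eq_zero]
  apply ode_unique _ (PowerSeries.derivative R (Qser t x) * (Psi t x - (1 - PowerSeries.C t)) + Ptser 1 x)
  · simp [Psi_const, Den, Etser, Eser, map_prod]
  · have hQ := deriv_Q t x
    have e1 := deriv_prod t x
    have e2 := deriv_prod 1 x
    have hC : (1 - PowerSeries.C t) = PowerSeries.C (1 - t) := by simp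
    have e3 : PowerSeries.derivative R (1 - PowerSeries.C t) = 0 := by
      rw [hC, PowerSeries.derivative_C]
    have e4 := deriv_Psi t x
    simp only [Den, Eser_eq, map_sub, Derivation.leibniz, smul_eq_mul, e1, e2, e4,
      PowerSeries.derivative_C, PowerSeries.derivative_one, map_one]
    linear_combination (Psi t x - (1 - PowerSeries.C t)) * Etser t x * hQ

lemma Cser_eq [IsDomain R] (t : R) (x : Fin k → R) (ht : t ≠ 1) :
    Cser t x = PowerSeries.X * Ptser t x * Psi t x := by
  apply mul_right_cancel₀ (Den_ne_zero t x ht)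
  rw [Cser_mul_Den, mul_assoc, Psi_mul_Den]
  ring

lemma Psi_eq [IsDomain R] (t : R) (x : Fin k → R) (ht : t ≠ 1) :
    Psi t x = 1 - PowerSeries.C t + PowerSeries.C t * Vser t x := by
  apply mul_right_cancel₀ (Den_ne_zero t x ht)
  rw [Psi_mul_Den, add_mul, mul_assoc, Vser_mul_Den, Den]
  ring

end comp


section special

/-- the ring `ℚ[x][t]` -/
abbrev RR (k : ℕ) : Type := Polynomial (MvPolynomial (Fin k) ℚ)

/-- the letters in `ℚ[x][t]` -/
def xx (k : ℕ) (c : Fin k) : RR k := Polynomial.C (MvPolynomial.X c)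

/-- the variable `t` -/
def tt (k : ℕ) : RR k := Polynomial.X

lemma C_xw {n k : ℕ} (w : Fin n → Fin k) : Polynomial.C (xw ℚ w) = ∏ i, xx k (w i) := by
  simp [xw, xx, map_prod]

lemma coeff_Vser (n k : ℕ) : PowerSeries.coeff (n + 1) (Vser (tt k) (xx k)) =
    smirnovEnum ℚ (n + 1) k desc (fun _ => True) := by
  have h := sum_words (tt k) (xx k) (fun _ => 1) n (fun _ => 1)
  simp only [mul_one, one_mul] at h
  simp only [Vser, gser, map_add, map_sum, PowerSeries.coeff_succ_X_mul, PowerSeries.coeff_mk,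
    PowerSeries.coeff_one, Nat.succ_ne_zero, if_false, zero_add]
  rw [← h, smirnovEnum, Finset.sum_filter]
  refine Finset.sum_congr rfl fun w _ => ?_
  rw [← smirnov_weight, C_xw, tt]
  by_cases hw : IsSmirnov w <;> simp [hw]

lemma coeff_Cser (n k : ℕ) : PowerSeries.coeff (n + 1) (Cser (tt k) (xx k)) =
    smirnovEnum ℚ (n + 1) k cdesc (fun _ => True) := by
  have h := fun a : Fin k => sum_words (tt k) (xx k) (fun b => if b = a then 1 else 0) n
    (fun c => if c.val < a.val + 1 then 1 else tt k)
  have h2 : PowerSeries.coeff (n + 1) (Cser (tt k) (xx k)) = ∑ a : Fin k,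
      ∑ b, gword (tt k) (xx k) (fun b => if b = a then 1 else 0) n b *
        (if b.val < a.val + 1 then 1 else tt k) := by
    simp only [Cser, Ssum, map_sum]
    refine Finset.sum_congr rfl fun a _ => Finset.sum_congr rfl fun b _ => ?_
    split_ifs
    · simp only [gser, one_mul, mul_one, PowerSeries.coeff_succ_X_mul, PowerSeries.coeff_mk]
    · simp only [gser, PowerSeries.coeff_C_mul, PowerSeries.coeff_succ_X_mul, PowerSeries.coeff_mk]
      ring
  rw [h2]
  simp only [← h]
  rw [Finset.sum_comm, smirnovEnum, Finset.sum_filter]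
  refine Finset.sum_congr rfl fun w _ => ?_
  rw [Finset.sum_eq_single (w 0)]
  · have hc := smirnov_cweight (tt k) w
    have e : (if (w (Fin.last n)).val < (w 0).val + 1 then 1 else tt k) =
        if w 0 < w (Fin.last n) then tt k else 1 := by
      by_cases hlt : w 0 < w (Fin.last n)
      · have : (w 0).val < (w (Fin.last n)).val := hlt
        rw [if_pos hlt, if_neg (by omega)]
      · have : ¬ (w 0).val < (w (Fin.last n)).val := hlt
        rw [if_neg hlt, if_pos (by omega)]
    rw [e, C_xw]
    simp only [if_true, one_mul, and_true]
    rw [mul_right_comm, ← hc]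
    by_cases hw : IsSmirnov w <;> simp [hw, tt]
  · intro a _ ha
    simp [ha.symm]
  · simp

lemma tt_ne_one (k : ℕ) : tt k ≠ 1 := by
  intro h
  have := congrArg (fun p => Polynomial.coeff p 1) h
  simp [tt, Polynomial.coeff_one] at this

/-- the ideal of non-squarefree monomials -/
def sqI (k : ℕ) : Ideal (RR k) := Ideal.span (Set.range fun i : Fin k => xx k i ^ 2)

lemma psum_mem (k i : ℕ) (c : Fin k) (hi : 2 ≤ i) : xx k c ^ i ∈ sqI k := by
  obtain ⟨j, rfl⟩ := Nat.exists_eq_add_of_le hi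
  rw [pow_add]
  exact Ideal.mul_mem_right _ _ (Ideal.subset_span ⟨c, rfl⟩)

lemma map_Qser {S : Type} [CommRing S] (k : ℕ) (π : RR k →+* S) (hπ : ∀ p ∈ sqI k, π p = 0) :
    PowerSeries.map π (Qser (tt k) (xx k)) = (π (∑ c, xx k c)) • PowerSeries.X := by
  ext i
  rw [PowerSeries.coeff_map, PowerSeries.coeff_smul, PowerSeries.coeff_X, Qser, PowerSeries.coeff_mk, qco]
  rcases i with _ | _ | i
  · simp
  · simp
  · rw [if_neg (by omega), smul_zero]
    apply hπ
    rw [Algebra.smul_def]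
    refine Ideal.mul_mem_left _ _ (Ideal.mul_mem_left _ _ (Ideal.sum_mem _ fun c _ => ?_))
    exact psum_mem k _ c (by omega)

lemma map_Psi {S : Type} [CommRing S] (n k : ℕ) (π : RR k →+* S) (hπ : ∀ p ∈ sqI k, π p = 0) :
    π (PowerSeries.coeff n (Psi (tt k) (xx k))) = π ((∑ c, xx k c) ^ n * bco (tt k) n) := by
  have hm : PowerSeries.map π ((Phi (tt k)).subst (Qser (tt k) (xx k))) =
      (PowerSeries.map π (Phi (tt k))).subst (PowerSeries.map π (Qser (tt k) (xx k))) :=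
    PowerSeries.map_subst (Qser_hasSubst (tt k) (xx k)) (h := π) (Phi (tt k))
  rw [← PowerSeries.coeff_map, Psi, hm, map_Qser k π hπ, ← PowerSeries.rescale_eq_subst,
    PowerSeries.coeff_rescale]
  simp [Phi]

lemma Psi_mod (n k : ℕ) : PowerSeries.coeff n (Psi (tt k) (xx k)) -
    (∑ c, xx k c) ^ n * bco (tt k) n ∈ sqI k := by
  have h := map_Psi (S := RR k ⧸ sqI k) n k (Ideal.Quotient.mk (sqI k))
    (fun p hp => Ideal.Quotient.eq_zero_iff_mem.mpr hp)
  exact Ideal.Quotient.eq.mp h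

/-- coefficient of `t^d x_1⋯x_k` -/
def phi (k d : ℕ) (p : RR k) : ℚ :=
  MvPolynomial.coeff (Finsupp.equivFunOnFinite.symm fun _ : Fin k => 1) (p.coeff d)

lemma phi_add (k d : ℕ) (p q : RR k) : phi k d (p + q) = phi k d p + phi k d q := by
  simp [phi]

lemma phi_sub (k d : ℕ) (p q : RR k) : phi k d (p - q) = phi k d p - phi k d q := by
  simp [phi]

lemma phi_sum {ι : Type} (k d : ℕ) (s : Finset ι) (p : ι → RR k) :
    phi k d (∑ i ∈ s, p i) = ∑ i ∈ s, phi k d (p i) := by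
  simp [phi, MvPolynomial.coeff_sum]

lemma phi_mem (k d : ℕ) (p : RR k) (hp : p ∈ sqI k) : phi k d p = 0 := by
  obtain ⟨c, rfl⟩ := (Ideal.mem_span_range_iff_exists_fun).mp hp
  rw [phi_sum]
  refine Finset.sum_eq_zero fun i _ => ?_
  rw [xx, ← map_pow, phi, Polynomial.coeff_mul_C, pow_two, ← mul_assoc, MvPolynomial.coeff_mul_X']
  split_ifs
  · rw [MvPolynomial.coeff_mul_X', if_neg]
    simp
  · rfl

lemma coeff_xw (k : ℕ) (w : Fin k → Fin k) :
    MvPolynomial.coeff (Finsupp.equivFunOnFinite.symm fun _ : Fin k => 1) (xw ℚ w) =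
      if Function.Bijective w then 1 else 0 := by
  have h1 : xw ℚ w = MvPolynomial.monomial (∑ i, Finsupp.single (w i) 1) 1 := by
    rw [xw, MvPolynomial.monomial_sum_one]
    rfl
  rw [h1, MvPolynomial.coeff_monomial]
  congr 1
  apply propext
  constructor
  · intro h
    apply Finite.injective_iff_bijective.mp
    apply Finite.injective_iff_surjective.mpr
    intro j
    by_contra hj
    push Not at hj
    have := DFunLike.congr_fun h j
    simp [Finsupp.finsetSum_apply, hj] at this
  · intro h
    ext j
    obtain ⟨i, rfl⟩ := h.2 j
    simp [Finsupp.finsetSum_apply, Finsupp.single_apply, h.1.eq_iff]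

lemma sum_bij {M : Type} [AddCommMonoid M] (k : ℕ) (F : (Fin k → Fin k) → M) :
    ∑ w : Fin k → Fin k, (if Function.Bijective w then F w else 0) =
      ∑ σ : Equiv.Perm (Fin k), F σ := by
  rw [← Finset.sum_filter]
  symm
  refine Finset.sum_bij' (fun σ _ => (σ : Fin k → Fin k))
    (fun w hw => Equiv.ofBijective w (Finset.mem_filter.mp hw).2) ?_ ?_ ?_ ?_ ?_
  · intro σ _; exact Finset.mem_filter.mpr ⟨Finset.mem_univ _, σ.bijective⟩
  · intro w _; simp
  · intro σ _; ext; simp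
  · intro w _; rfl
  · intro σ _; rfl

lemma bco_eq_map (k m : ℕ) : bco (tt k) m =
    Polynomial.map MvPolynomial.C (bco (Polynomial.X : Polynomial ℚ) m) := by
  have := bco_map (Polynomial.mapRingHom (MvPolynomial.C : ℚ →+* MvPolynomial (Fin k) ℚ)) Polynomial.X m
  simp only [Polynomial.coe_mapRingHom, Polynomial.map_X] at this
  rw [this, tt]

lemma bco_Eul (n : ℕ) : ((n + 1).factorial : Polynomial ℚ) * bco (Polynomial.X : Polynomial ℚ) (n + 1) =
    Polynomial.X * Eul ℚ (n + 1) := by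
  have h := Psi_mod (n + 1) (n + 1)
  rw [Psi_eq _ _ (tt_ne_one _), map_add, PowerSeries.coeff_C_mul, coeff_Vser] at h
  have h0 : PowerSeries.coeff (n + 1) (1 - PowerSeries.C (tt (n + 1))) = 0 := by
    simp [PowerSeries.coeff_one]
  rw [h0, zero_add] at h
  ext d
  have hd := phi_mem _ d _ h
  rw [phi_sub, sub_eq_zero] at hd
  have e1 : phi (n + 1) d (tt (n + 1) * smirnovEnum ℚ (n + 1) (n + 1) desc (fun _ => True)) =
      (Polynomial.X * Eul ℚ (n + 1)).coeff d := by
    rw [smirnovEnum, Finset.sum_filter, Finset.mul_sum, phi_sum, Eul, Finset.mul_sum,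
      Polynomial.finsetSum_coeff, ← sum_bij (n + 1)
        (fun w => (Polynomial.X * Polynomial.X ^ desc w : Polynomial ℚ).coeff d)]
    refine Finset.sum_congr rfl fun w _ => ?_
    by_cases hb : Function.Bijective w
    · have hs : IsSmirnov w := by
        intro i hi heq
        have := hb.1 heq
        simp [Fin.ext_iff] at this
      simp only [hs, hb, and_true, if_true]
      rw [tt, ← mul_assoc, ← pow_succ', phi, Polynomial.coeff_mul_C, Polynomial.coeff_X_pow, ← pow_succ',
        Polynomial.coeff_X_pow]
      split_ifs
      · rw [one_mul, coeff_xw, if_pos hb]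
      · simp
    · rw [if_neg hb]
      split_ifs
      · rw [tt, ← mul_assoc, ← pow_succ', phi, Polynomial.coeff_mul_C, Polynomial.coeff_X_pow]
        split_ifs
        · rw [one_mul, coeff_xw, if_neg hb]
        · simp
      · simp [phi]
  have e2 : phi (n + 1) d ((∑ c, xx (n + 1) c) ^ (n + 1) * bco (tt (n + 1)) (n + 1)) =
      (((n + 1).factorial : Polynomial ℚ) * bco (Polynomial.X : Polynomial ℚ) (n + 1)).coeff d := by
    have e3 : (∑ c, xx (n + 1) c) ^ (n + 1) = ∑ w : Fin (n + 1) → Fin (n + 1), Polynomial.C (xw ℚ w) := by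
      simp only [C_xw]
      rw [← Fintype.piFinset_univ, ← Finset.prod_univ_sum]
      simp
    rw [e3, Finset.sum_mul, phi_sum, bco_eq_map]
    have e4 : ∀ w : Fin (n + 1) → Fin (n + 1), phi (n + 1) d (Polynomial.C (xw ℚ w) *
        Polynomial.map MvPolynomial.C (bco (Polynomial.X : Polynomial ℚ) (n + 1))) =
        if Function.Bijective w then (bco (Polynomial.X : Polynomial ℚ) (n + 1)).coeff d else 0 := by
      intro w
      rw [phi, Polynomial.coeff_C_mul, Polynomial.coeff_map, mul_comm, MvPolynomial.coeff_C_mul, coeff_xw]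
      simp
    simp only [e4]
    rw [sum_bij (n + 1) (fun _ => (bco (Polynomial.X : Polynomial ℚ) (n + 1)).coeff d)]
    rw [← Polynomial.C_eq_natCast, Polynomial.coeff_C_mul]
    simp [Fintype.card_perm]
  rw [← e1, ← e2, hd]

lemma Eul_map (k m : ℕ) : Eul (MvPolynomial (Fin k) ℚ) m = Polynomial.map MvPolynomial.C (Eul ℚ m) := by
  simp [Eul, Polynomial.map_sum]

lemma bco_Eul' (k m : ℕ) (hm : m ≠ 0) : (m.factorial : RR k) * bco (tt k) m =
    Polynomial.X * Eul (MvPolynomial (Fin k) ℚ) m := by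
  obtain ⟨n, rfl⟩ := Nat.exists_eq_succ_of_ne_zero hm
  have := congrArg (Polynomial.map (MvPolynomial.C : ℚ →+* MvPolynomial (Fin k) ℚ)) (bco_Eul n)
  rw [Eul_map, bco_eq_map]
  simpa using this

end special


section partitions

lemma polarized {B : Type} [CommRing B] (s : Finset ℕ) (u v : ℕ → B) (m : ℕ) :
    ((m : B) + 1) * ((∑ i ∈ s, v i) * (∑ i ∈ s, u i) ^ m) =
      ∑ κ ∈ s.sym (m + 1), (κ.val.countPerms : B) *
        (κ.val.map (fun a => v a * ((κ.val.erase a).map u).prod)).sum := by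
  have h := Finset.sum_pow (s := s)
    (fun i => Polynomial.C (u i) + Polynomial.X * Polynomial.C (v i)) (m + 1)
  have h2 := congrArg (fun p => Polynomial.eval 0 (Polynomial.derivative p)) h
  simp only [Polynomial.derivative_pow_succ, Polynomial.derivative_sum, Polynomial.derivative_add,
    Polynomial.derivative_C, Polynomial.derivative_mul, Polynomial.derivative_X,
    Polynomial.eval_finsetSum, Polynomial.derivative_natCast, zero_mul, zero_add, mul_zero,
    add_zero, one_mul, Polynomial.eval_mul, Polynomial.eval_pow, Polynomial.eval_C, Polynomial.eval_add,
    Polynomial.eval_X, Polynomial.eval_natCast, Polynomial.derivative_prod] at h2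
  have h3 : ((m : B) + 1) * ((∑ i ∈ s, v i) * (∑ i ∈ s, u i) ^ m) =
     ((m : B) + 1) * (∑ i ∈ s, u i) ^ m * (∑ i ∈ s, v i) := by ring
  rw [h3]
  rw [h2]
  refine Finset.sum_congr rfl fun κ _ => ?_
  congr 1
  rw [← Polynomial.coe_evalRingHom, map_multiset_sum, Multiset.map_map]
  congr 1
  refine Multiset.map_congr rfl fun a _ => ?_
  simp only [Function.comp, map_mul, map_multiset_prod, Multiset.map_map]
  rw [mul_comm (v a)]
  simp

lemma countPerms_spec (m : Multiset ℕ) :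
    (∏ i ∈ m.toFinset, (m.count i).factorial) * m.countPerms = m.card.factorial := by
  have := Nat.multinomial_spec m.toFinset (fun i => m.count i)
  rw [Multiset.toFinset_sum_count_eq] at this
  rw [← this]
  congr 1

variable {R : Type} [CommRing R]

lemma trunc_dvd (n : ℕ) (q : ℕ → R) (h0 : q 0 = 0) :
    PowerSeries.X ^ (n + 1) ∣ PowerSeries.mk q -
      ∑ i ∈ Finset.Icc 1 n, PowerSeries.C (q i) * PowerSeries.X ^ i := by
  rw [PowerSeries.X_pow_dvd_iff]
  intro m hm
  rw [map_sub, map_sum, PowerSeries.coeff_mk, sub_eq_zero]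
  simp only [PowerSeries.coeff_C_mul, PowerSeries.coeff_X_pow, mul_ite, mul_one, mul_zero]
  rw [Finset.sum_ite_eq]
  split_ifs with h
  · rfl
  · have : m = 0 := by
      simp at h
      omega
    rw [this, h0]

lemma coeff_LQ (n m : ℕ) (q l : ℕ → R) (hq : q 0 = 0) (hl : l 0 = 0) :
    ((m : R) + 1) * PowerSeries.coeff n (PowerSeries.mk l * PowerSeries.mk q ^ m) =
      ∑ μ : n.Partition, if μ.parts.card = m + 1 then (μ.parts.countPerms : R) *
        (μ.parts.map (fun a => l a * ((μ.parts.erase a).map q).prod)).sum else 0 := by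
  set u : ℕ → PowerSeries R := fun i => PowerSeries.C (q i) * PowerSeries.X ^ i with hu
  set v : ℕ → PowerSeries R := fun i => PowerSeries.C (l i) * PowerSeries.X ^ i with hv
  have h1 : PowerSeries.coeff n (PowerSeries.mk l * PowerSeries.mk q ^ m) =
      PowerSeries.coeff n ((∑ i ∈ Finset.Icc 1 n, v i) * (∑ i ∈ Finset.Icc 1 n, u i) ^ m) := by
    have d1 := trunc_dvd n q hq
    have d2 := trunc_dvd n l hl
    have d3 := d1.trans (sub_dvd_pow_sub_pow (PowerSeries.mk q) (∑ i ∈ Finset.Icc 1 n, u i) m)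
    have d4 : PowerSeries.X ^ (n + 1) ∣ PowerSeries.mk l * PowerSeries.mk q ^ m -
      (∑ i ∈ Finset.Icc 1 n, v i) * (∑ i ∈ Finset.Icc 1 n, u i) ^ m := by
      have := dvd_add (d2.mul_right (PowerSeries.mk q ^ m)) (d3.mul_left (∑ i ∈ Finset.Icc 1 n, v i))
      convert this using 1
      ring
    have := PowerSeries.X_pow_dvd_iff.mp d4 n (by omega)
    rwa [map_sub, sub_eq_zero] at this
  have hcast : ((m : PowerSeries R) + 1) = PowerSeries.C ((m : R) + 1) := by simp
  have h2 := congrArg (PowerSeries.coeff n) (polarized (Finset.Icc 1 n) u v m)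
  rw [hcast, PowerSeries.coeff_C_mul, ← h1] at h2
  rw [h2, map_sum]
  have h3 : ∀ κ : Multiset ℕ, (κ.countPerms : PowerSeries R) *
        (κ.map (fun a => v a * ((κ.erase a).map u).prod)).sum =
      PowerSeries.C ((κ.countPerms : R) * (κ.map (fun a => l a * ((κ.erase a).map q).prod)).sum) *
        PowerSeries.X ^ κ.sum := by
    intro κ
    rw [map_mul, map_natCast, mul_assoc, map_multiset_sum, Multiset.map_map, ← Multiset.sum_map_mul_right]
    congr 2
    refine Multiset.map_congr rfl fun a ha => ?_
    simp only [hu, hv, Function.comp, map_mul, map_multiset_prod, Multiset.map_map, Multiset.prod_map_mul]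
    have hs : κ.sum = a + (κ.erase a).sum := by
      rw [← Multiset.sum_cons, Multiset.cons_erase ha]
    have hp : ((κ.erase a).map (fun i => (PowerSeries.X : PowerSeries R) ^ i)).prod =
        PowerSeries.X ^ (κ.erase a).sum := by
      induction κ.erase a using Multiset.induction_on with
      | empty => simp
      | cons b m ih => rw [Multiset.map_cons, Multiset.prod_cons, ih, Multiset.sum_cons, pow_add]
    rw [hp, hs, pow_add]
    ring
  simp only [h3, PowerSeries.coeff_C_mul, PowerSeries.coeff_X_pow, mul_ite, mul_one, mul_zero]
  rw [← Finset.sum_filter, ← Finset.sum_filter]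
  symm
  refine Finset.sum_bij' (fun μ hμ => (⟨μ.parts, (Finset.mem_filter.mp hμ).2⟩ : Sym ℕ (m + 1)))
    (fun κ hκ => (⟨κ.val, fun {i} hi => ?_, ?_⟩ : n.Partition)) ?_ ?_ ?_ ?_ ?_
  · have := Finset.mem_sym_iff.mp (Finset.mem_filter.mp hκ).1 i hi
    simp at this
    omega
  · exact (Finset.mem_filter.mp hκ).2.symm
  · intro μ hμ
    refine Finset.mem_filter.mpr ⟨Finset.mem_sym_iff.mpr fun i hi => ?_, μ.parts_sum.symm⟩
    have hi' : i ∈ μ.parts := hi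
    have := μ.parts_pos hi'
    have h4 := Multiset.le_sum_of_mem hi'
    rw [μ.parts_sum] at h4
    simp
    omega
  · intro κ hκ
    exact Finset.mem_filter.mpr ⟨Finset.mem_univ _, κ.2⟩
  · intro μ hμ
    rfl
  · intro κ hκ
    rfl
  · intro μ hμ
    rfl

variable [Algebra ℚ R] {k : ℕ}

/-- coefficients of `t z P(tz)` -/
def lco (t : R) (x : Fin k → R) (i : ℕ) : R :=
  ((-1 : ℚ) ^ (i - 1) / (i : ℚ)) • (((i : R) * t ^ i) * ∑ c, x c ^ i)

lemma Lser_eq (t : R) (x : Fin k → R) :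
    PowerSeries.C t * (PowerSeries.X * Ptser t x) = PowerSeries.mk (lco t x) := by
  ext i
  rw [PowerSeries.coeff_C_mul, PowerSeries.coeff_mk]
  cases i with
  | zero => simp [lco]
  | succ i =>
    rw [PowerSeries.coeff_succ_X_mul]
    simp only [Ptser, map_sum, PowerSeries.coeff_C_mul, PowerSeries.coeff_mk, lco]
    have h1 : (((i + 1 : ℕ) : R)) = algebraMap ℚ R ((i : ℚ) + 1) := by simp
    rw [Algebra.smul_def, h1, ← mul_assoc, ← mul_assoc, ← map_mul]
    have h2 : ((-1 : ℚ) ^ (i + 1 - 1) / ((i + 1 : ℕ) : ℚ)) * ((i : ℚ) + 1) = (-1) ^ i := by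
      have : ((i : ℚ) + 1) ≠ 0 := by positivity
      push_cast
      field_simp
    rw [h2, Finset.mul_sum, Finset.mul_sum]
    refine Finset.sum_congr rfl fun c _ => ?_
    rw [neg_pow, mul_pow]
    simp
    ring

lemma coeff_LPsi (n : ℕ) (t : R) (x : Fin k → R) :
    PowerSeries.coeff n (PowerSeries.mk (lco t x) * Psi t x) =
      ∑ m ∈ Finset.range n, bco t m *
        PowerSeries.coeff n (PowerSeries.mk (lco t x) * PowerSeries.mk (qco t x) ^ m) := by
  have h1 : ∀ j < n, PowerSeries.coeff j (Psi t x) =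
      ∑ m ∈ Finset.range n, bco t m * PowerSeries.coeff j (Qser t x ^ m) := by
    intro j hj
    rw [Psi, PowerSeries.coeff_subst' (Qser_hasSubst t x),
      finsum_eq_sum_of_support_subset (s := Finset.range n)]
    · simp only [Phi, PowerSeries.coeff_mk, smul_eq_mul]
    · intro m hm
      by_contra hmn
      apply hm
      have hmn : n ≤ m := by simpa using hmn
      have : (PowerSeries.X : PowerSeries R) ^ m ∣ Qser t x ^ m :=
        pow_dvd_pow_of_dvd (PowerSeries.X_dvd_iff.mpr (Qser_const t x)) m
      have h0 := PowerSeries.X_pow_dvd_iff.mp this j (by omega)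
      simp only [h0, smul_zero]
  simp only [PowerSeries.coeff_mul, Finset.mul_sum]
  rw [Finset.sum_comm]
  refine Finset.sum_congr rfl ?_
  rintro ⟨i, j⟩ hij
  have hij : i + j = n := by simpa using hij
  rcases Nat.eq_zero_or_pos i with rfl | hi
  · simp [lco]
  · simp only
    rw [h1 j (by omega), Finset.mul_sum]
    refine Finset.sum_congr rfl fun m _ => ?_
    simp only [Qser]
    ring

/-- scalar prefactor of a partition -/
lemma sign_prod (m : Multiset ℕ) (hm : ∀ a ∈ m, 0 < a) :
    m.card ≤ m.sum ∧ (m.map (fun a : ℕ => (-1 : ℚ) ^ (a - 1) / (a : ℚ))).prod =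
      (-1) ^ (m.sum - m.card) / ((m.prod : ℕ) : ℚ) := by
  induction m using Multiset.induction_on with
  | empty => simp
  | cons a m ih =>
    obtain ⟨h1, h2⟩ := ih fun b hb => hm b (Multiset.mem_cons_of_mem hb)
    have ha := hm a (Multiset.mem_cons_self a m)
    simp only [Multiset.card_cons, Multiset.sum_cons, Multiset.map_cons, Multiset.prod_cons]
    refine ⟨by omega, ?_⟩
    rw [h2, show a + m.sum - (m.card + 1) = (a - 1) + (m.sum - m.card) by omega, pow_add]
    push_cast
    rw [div_mul_div_comm]

lemma term_eq (t : R) (x : Fin k → R) (m : Multiset ℕ) :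
    (m.map (fun a => lco t x a * ((m.erase a).map (qco t x)).prod)).sum =
      algebraMap ℚ R (m.map (fun a : ℕ => (-1 : ℚ) ^ (a - 1) / (a : ℚ))).prod *
      (m.map (fun a : ℕ => ∑ c, x c ^ a)).prod *
      (m.map (fun a : ℕ => ((a : R) * t ^ a) *
        ((m.erase a).map (fun i => ∑ j ∈ Finset.range i, t ^ j)).prod)).sum := by
  rw [← Multiset.sum_map_mul_left]
  congr 1
  refine Multiset.map_congr rfl fun a ha => ?_
  obtain ⟨m', rfl⟩ := Multiset.exists_cons_of_mem ha
  simp only [Multiset.erase_cons_head, Multiset.map_cons, Multiset.prod_cons]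
  have hq : qco t x = fun i : ℕ => algebraMap ℚ R ((-1 : ℚ) ^ (i - 1) / (i : ℚ)) *
      ((∑ j ∈ Finset.range i, t ^ j) * ∑ c, x c ^ i) := by
    funext i
    rw [qco, Algebra.smul_def]
  rw [hq, lco, Algebra.smul_def, Multiset.prod_map_mul, Multiset.prod_map_mul, map_mul,
    map_multiset_prod, Multiset.map_map]
  simp only [Function.comp_def]
  ring

lemma zlam_eq {n : ℕ} (μ : n.Partition) :
    zlam μ = μ.parts.prod * ∏ i ∈ μ.parts.toFinset, (μ.parts.count i).factorial := by
  rw [zlam, Finset.prod_mul_distrib, Finset.prod_multiset_count]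

lemma zlam_perm {n : ℕ} (μ : n.Partition) :
    zlam μ * μ.parts.countPerms = μ.parts.prod * μ.parts.card.factorial := by
  rw [zlam_eq, mul_assoc, countPerms_spec]

lemma X_ctilde (k n : ℕ) (hn : 1 ≤ n) (μ : n.Partition) :
    Polynomial.X * ctilde k n μ = ((μ.parts.card - 1).factorial : RR k) * bco (tt k) (μ.parts.card - 1) *
      (μ.parts.map (fun a : ℕ => ((a : RR k) * tt k ^ a) *
        ((μ.parts.erase a).map (fun i => ∑ j ∈ Finset.range i, tt k ^ j)).prod)).sum := by
  have hcard : μ.parts.card ≠ 0 := by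
    intro h
    have h1 := μ.parts_sum
    rw [Multiset.card_eq_zero.mp h] at h1
    simp at h1
    omega
  unfold ctilde
  split_ifs with h
  · obtain ⟨a, ha⟩ := Multiset.card_eq_one.mp h
    have h1 := μ.parts_sum
    rw [ha] at h1
    simp at h1
    subst h1
    rw [h]
    simp only [ha]
    simp [bco, tt]
    obtain ⟨b, rfl⟩ := Nat.exists_eq_add_of_le' hn
    simp [pow_succ]
    ring
  · rw [bco_Eul' k _ (by omega), mul_assoc]
    simp only [tt]
    rfl

theorem main_expansion (n k : ℕ) (hn : 1 ≤ n) :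
    smirnovEnum ℚ n k cdesc (fun _ => True) =
      ∑ μ : n.Partition, ((-1 : ℚ) ^ (n - μ.parts.card) / (zlam μ : ℚ)) •
        (ctilde k n μ * Polynomial.C (psumPart (Fin k) ℚ μ)) := by
  have hX : (Polynomial.X : RR k) ≠ 0 := Polynomial.X_ne_zero
  apply mul_left_cancel₀ hX
  have h1 : Polynomial.X * smirnovEnum ℚ n k cdesc (fun _ => True) =
      PowerSeries.coeff n (PowerSeries.mk (lco (tt k) (xx k)) * Psi (tt k) (xx k)) := by
    obtain ⟨N, rfl⟩ := Nat.exists_eq_add_of_le' hn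
    rw [← coeff_Cser, Cser_eq _ _ (tt_ne_one k), ← Lser_eq, mul_assoc (PowerSeries.C _),
      PowerSeries.coeff_C_mul]
    rfl
  rw [h1, coeff_LPsi, Finset.mul_sum]
  have h2 : ∀ m : ℕ, PowerSeries.coeff n (PowerSeries.mk (lco (tt k) (xx k)) *
      PowerSeries.mk (qco (tt k) (xx k)) ^ m) = algebraMap ℚ (RR k) (1 / ((m : ℚ) + 1)) *
      ∑ μ : n.Partition, if μ.parts.card = m + 1 then (μ.parts.countPerms : RR k) *
        (μ.parts.map (fun a => lco (tt k) (xx k) a *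
          ((μ.parts.erase a).map (qco (tt k) (xx k))).prod)).sum else 0 := by
    intro m
    rw [← coeff_LQ n m _ _ (by simp [qco]) (by simp [lco])]
    have e : ((m : RR k) + 1) = algebraMap ℚ (RR k) ((m : ℚ) + 1) := by simp
    rw [e, ← mul_assoc, ← map_mul, one_div_mul_cancel (by positivity), map_one, one_mul]
  simp only [h2, Finset.mul_sum]
  rw [Finset.sum_comm]
  refine Finset.sum_congr rfl fun μ _ => ?_
  have hcard : μ.parts.card ≠ 0 := by
    intro h
    have h1 := μ.parts_sum
    rw [Multiset.card_eq_zero.mp h] at h1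
    simp at h1
    omega
  obtain ⟨ℓ, hℓ⟩ := Nat.exists_eq_succ_of_ne_zero hcard
  obtain ⟨hle, hsign⟩ := sign_prod μ.parts (fun a ha => μ.parts_pos ha)
  rw [μ.parts_sum] at hle hsign
  rw [Finset.sum_eq_single ℓ]
  · rw [if_pos hℓ, term_eq, hsign, mul_smul_comm, ← mul_assoc Polynomial.X, X_ctilde k n hn μ, hℓ]
    have hp : (μ.parts.map (fun a : ℕ => ∑ c, xx k c ^ a)).prod =
        Polynomial.C (psumPart (Fin k) ℚ μ) := by
      rw [psumPart, map_multiset_prod, Multiset.map_map]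
      congr 1
      refine Multiset.map_congr rfl fun a _ => ?_
      simp [psum, xx]
    have hz := zlam_perm μ
    rw [hℓ] at hz
    have hpp : 0 < μ.parts.prod := by
      apply Nat.pos_of_ne_zero
      exact Multiset.prod_ne_zero fun h0 => (μ.parts_pos h0).ne' rfl
    have hz0 : zlam μ ≠ 0 := by
      intro h0
      rw [h0, zero_mul] at hz
      have := Nat.mul_pos hpp (Nat.factorial_pos ℓ.succ)
      omega
    have hscal : (1 / ((ℓ : ℚ) + 1)) * (μ.parts.countPerms : ℚ) *
        ((-1) ^ (n - ℓ.succ) / ((μ.parts.prod : ℕ) : ℚ)) =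
        ((-1 : ℚ) ^ (n - ℓ.succ) / (zlam μ : ℚ)) * (ℓ.factorial : ℚ) := by
      have hzq : (zlam μ : ℚ) * μ.parts.countPerms = (μ.parts.prod : ℕ) * (((ℓ : ℚ) + 1) * ℓ.factorial) := by
        exact_mod_cast hz
      have a1 : (zlam μ : ℚ) ≠ 0 := by exact_mod_cast hz0
      have a2 : ((μ.parts.prod : ℕ) : ℚ) ≠ 0 := by exact_mod_cast hpp.ne'
      have a3 : ((ℓ : ℚ) + 1) ≠ 0 := by positivity
      rw [one_div, inv_mul_eq_div, div_mul_div_comm, div_mul_eq_mul_div, div_eq_div_iff (by positivity) a1]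
      linear_combination (-1 : ℚ) ^ (n - ℓ.succ) * hzq
    have hs2 := congrArg (algebraMap ℚ (RR k)) hscal
    simp only [map_mul, map_natCast] at hs2
    rw [hp, Algebra.smul_def]
    simp only [Nat.succ_sub_one]
    linear_combination (bco (tt k) ℓ * Polynomial.C (psumPart (Fin k) ℚ μ) *
      (μ.parts.map (fun a : ℕ => ((a : RR k) * tt k ^ a) *
        ((μ.parts.erase a).map (fun i => ∑ j ∈ Finset.range i, tt k ^ j)).prod)).sum) * hs2
  · intro m _ hm
    rw [if_neg (by omega)]
    simp
  · intro h
    exfalso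
    apply h
    simp
    omega

end partitions


/-- `W̃_n(x,t) = Σ_{λ ⊢ n} (-1)^{n-ℓ(λ)} c_λ(t) p_λ(x)/z_λ`. -/
theorem cyclic_smirnov_power_sum_expansion (n k : ℕ) (hn : 1 ≤ n) (hk : 1 ≤ k) :
    smirnovEnum ℚ n k cdesc (fun _ => True) =
      ∑ μ : n.Partition, ((-1 : ℚ) ^ (n - μ.parts.card) / (zlam μ : ℚ)) •
        (ctilde k n μ * Polynomial.C (psumPart (Fin k) ℚ μ)) := by
  exact main_expansion n k hn

end
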